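/- Let n, s be positive integers with n ≥ 2s, and let a ∈ {n−s+1, …, n}. Then #C_{n,s,a} = #C_{n,s−1} − ∑_{b=n−s+2}^{a} #C_{n,s−1,b}. -/

import Mathlib

open Polynomial

/-- `w` has an increasing subsequence of length `m`. -/
def HasIncSubseq {n : ℕ} (w : Equiv.Perm (Fin n)) (m : ℕ) : Prop :=
  ∃ f : Fin m → Fin n, StrictMono f ∧ StrictMono fun j => w (f j)

/-- The length of the longest increasing subsequence of `w`. -/
noncomputable def isLen {n : ℕ} (w : Equiv.Perm (Fin n)) : ℕ :=
  sSup {m | HasIncSubseq w m}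

/-- The first `n - s` values of `w` are increasing (positions `0,…,n-s-1` in 0-indexing,
i.e. `w(1) < ⋯ < w(n-s)` in 1-indexing). -/
def PrefixInc (n s : ℕ) (w : Equiv.Perm (Fin n)) : Prop :=
  ∀ i j : Fin n, (i : ℕ) < j → (j : ℕ) < n - s → w i < w j

/-- Major index of a permutation: the sum of the (1-indexed) descent positions.
Position `i ∈ {0,…,n-2}` (0-indexed) contributes `i + 1`. -/
def maj {n : ℕ} (σ : Equiv.Perm (Fin n)) : ℕ :=
  ∑ i ∈ Finset.range n,
    if h : i + 1 < n then
      if σ ⟨i + 1, h⟩ < σ ⟨i, Nat.lt_of_succ_lt h⟩ then i + 1 else 0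
    else 0

/-- The q-integer `[m]_q = 1 + q + ⋯ + q^{m-1}` as a polynomial in `q = X` over `ℤ`. -/
noncomputable def qInt (m : ℕ) : Polynomial ℤ :=
  ∑ i ∈ Finset.range m, (X : Polynomial ℤ) ^ i

/-- The set `Π_{n,k}` of permutations whose first `n - k` values are increasing and whose
longest increasing subsequence has length exactly `n - k`, as a `Finset`. -/
noncomputable def PiFinset (n k : ℕ) : Finset (Equiv.Perm (Fin n)) :=
  @Finset.filter _ (fun w => PrefixInc n k w ∧ isLen w = n - k) (Classical.decPred _)
    Finset.univ

/-- The set `C_{n,s}` of permutations whose first `n - s` values are increasing,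
as a `Finset`. -/
noncomputable def CFinset (n s : ℕ) : Finset (Equiv.Perm (Fin n)) :=
  @Finset.filter _ (fun w => PrefixInc n s w) (Classical.decPred _) Finset.univ

/-- The prefix `w(1),…,w(a)` (1-indexed) contains an increasing subsequence of length `m`. -/
def HasIncSubseqPrefix {n : ℕ} (w : Equiv.Perm (Fin n)) (a m : ℕ) : Prop :=
  ∃ f : Fin m → Fin n, StrictMono f ∧ (∀ j, (f j : ℕ) < a) ∧ StrictMono fun j => w (f j)

/-- Membership in `C_{n,s,a}`: `π ∈ C_{n,s}`, the prefix of length `a` contains an increasing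
subsequence of length `n - s + 1`, but the prefix of length `a - 1` does not. -/
def MemCa (n s a : ℕ) (π : Equiv.Perm (Fin n)) : Prop :=
  PrefixInc n s π ∧ HasIncSubseqPrefix π a (n - s + 1) ∧
    ¬ HasIncSubseqPrefix π (a - 1) (n - s + 1)

/-- The set `C_{n,s,a}` as a `Finset`. -/
noncomputable def CaFinset (n s a : ℕ) : Finset (Equiv.Perm (Fin n)) :=
  @Finset.filter _ (fun π => MemCa n s a π) (Classical.decPred _) Finset.univ

section RowInsertion

variable {α : Type*} [LinearOrder α]

/-- `RowInsertion l R rec` says that row-inserting the letters of `l`, the last letter of the list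
first, into an empty row yields the row `R`. The list `rec` records, in the order of `l`, the
letter bumped by each insertion, with `none` if the letter is appended at the end of the row. -/
inductive RowInsertion : List α → Finset α → List (Option α) → Prop
  | nil : RowInsertion [] ∅ []
  | append {l R rec p} : RowInsertion l R rec → (∀ x ∈ R, x < p) →
      RowInsertion (p :: l) (insert p R) (none :: rec)
  | bump {l R rec p y} : RowInsertion l R rec → p ∉ R → y ∈ R → p < y →
      (∀ x ∈ R, p < x → y ≤ x) → RowInsertion (p :: l) (insert p (R.erase y)) (some y :: rec)

namespace RowInsertion

variable {l l' : List α} {R R' : Finset α} {rec rec' : List (Option α)}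

theorem length_eq (h : RowInsertion l R rec) : rec.length = l.length := by
  induction h <;> simp_all

theorem card_eq (h : RowInsertion l R rec) : R.card = rec.count none := by
  induction h with
  | nil => simp
  | append h hp ih => rw [Finset.card_insert_of_notMem fun hR => (hp _ hR).false]; simp [ih]
  | bump h hp hy hpy hmin ih =>
    rw [Finset.card_insert_of_notMem fun hR => hp (Finset.mem_of_mem_erase hR),
      Finset.card_erase_add_one hy]
    simp [ih]

theorem perm (h : RowInsertion l R rec) : l.Perm (R.toList ++ rec.reduceOption) := by
  induction h with
  | nil => simp
  | @append l R rec p h hp ih =>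
    have hpR : p ∉ R := fun hR => (hp _ hR).false
    rw [List.reduceOption_cons_of_none]
    exact (ih.cons p).trans ((Finset.toList_insert hpR).symm.append_right _)
  | @bump l R rec p y h hp hy hpy hmin ih =>
    rw [List.reduceOption_cons_of_some]
    have hpR : p ∉ R.erase y := fun hR => hp (Finset.mem_of_mem_erase hR)
    have hR : R.toList.Perm (y :: (R.erase y).toList) := by
      conv_lhs => rw [← Finset.insert_erase hy]
      exact Finset.toList_insert (Finset.notMem_erase y R)
    refine (ih.cons p).trans ?_
    refine List.Perm.trans ?_ ((Finset.toList_insert hpR).symm.append_right _)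
    refine List.Perm.cons p ((hR.append_right _).trans ?_)
    exact List.perm_middle.symm

theorem subset (h : RowInsertion l R rec) {x : α} (hx : x ∈ R) : x ∈ l :=
  h.perm.mem_iff.2 (by simp [hx])

theorem drop (h : RowInsertion l R rec) (j : ℕ) :
    ∃ R', RowInsertion (l.drop j) R' (rec.drop j) := by
  induction h generalizing j with
  | nil => exact ⟨∅, by simpa using nil⟩
  | append h hp ih =>
    cases j with
    | zero => exact ⟨_, h.append hp⟩
    | succ j => simpa using ih j
  | bump h hp hy hpy hmin ih =>
    cases j with
    | zero => exact ⟨_, h.bump hp hy hpy hmin⟩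
    | succ j => simpa using ih j

theorem exists_of_nodup (hl : l.Nodup) : ∃ R rec, RowInsertion l R rec := by
  induction l with
  | nil => exact ⟨_, _, nil⟩
  | cons p l ih =>
    obtain ⟨hp, hl⟩ := List.nodup_cons.1 hl
    obtain ⟨R, rec, h⟩ := ih hl
    by_cases hR : ∀ x ∈ R, x < p
    · exact ⟨_, _, h.append hR⟩
    · push Not at hR
      have hpR : p ∉ R := fun hR => hp (h.subset hR)
      obtain ⟨x, hx, hpx⟩ := hR
      have hne : (R.filter (p < ·)).Nonempty :=
        ⟨x, Finset.mem_filter.2 ⟨hx, lt_of_le_of_ne hpx fun e => hpR (e ▸ hx)⟩⟩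
      obtain ⟨h1, h2⟩ := Finset.mem_filter.1 (Finset.min'_mem _ hne)
      exact ⟨_, _, h.bump hpR h1 h2 fun x hx hpx =>
        Finset.min'_le _ _ (Finset.mem_filter.2 ⟨hx, hpx⟩)⟩

theorem exists_replicate (R : Finset α) :
    ∃ l, RowInsertion l R (List.replicate R.card none) := by
  induction R using Finset.induction_on_max with
  | empty => exact ⟨[], nil⟩
  | insert p R hp ih =>
    obtain ⟨l, h⟩ := ih
    refine ⟨p :: l, ?_⟩
    rw [Finset.card_insert_of_notMem fun hR => (hp _ hR).false]
    exact h.append hp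

theorem unique (h : RowInsertion l R rec) (h' : RowInsertion l R' rec') :
    R = R' ∧ rec = rec' := by
  induction h generalizing R' rec' with
  | nil => cases h'; simp
  | append h hp ih =>
    cases h' with
    | append h' hp' => obtain ⟨rfl, rfl⟩ := ih h'; simp
    | bump h' _ hy hpy _ => obtain ⟨rfl, rfl⟩ := ih h'; exact absurd (hp _ hy) hpy.not_gt
  | bump h _ hy hpy hmin ih =>
    cases h' with
    | append h' hp' => obtain ⟨rfl, rfl⟩ := ih h'; exact absurd (hp' _ hy) hpy.not_gt
    | bump h' _ hy' hpy' hmin' =>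
      obtain ⟨rfl, rfl⟩ := ih h'
      obtain rfl := le_antisymm (hmin _ hy' hpy') (hmin' _ hy hpy)
      simp

theorem injective (h : RowInsertion l R rec) (h' : RowInsertion l' R rec) : l = l' := by
  induction h generalizing l' with
  | nil => simpa [eq_comm] using h'.length_eq
  | @append l R rec p h hp ih =>
    generalize hS : insert p R = S at h'
    cases h' with
    | @append l' R' _ p' h' hp' =>
      have hpR : p ∉ R := fun hR => (hp _ hR).false
      have hpR' : p' ∉ R' := fun hR => (hp' _ hR).false
      obtain rfl : p = p' := by
        have h1 : p ∈ insert p' R' := hS ▸ Finset.mem_insert_self p R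
        have h2 : p' ∈ insert p R := hS ▸ Finset.mem_insert_self p' R'
        grind
      obtain rfl : R = R' := by
        rw [← Finset.erase_insert hpR, hS, Finset.erase_insert hpR']
      rw [ih h']
  | @bump l R rec p y h hp hy hpy hmin ih =>
    generalize hS : insert p (R.erase y) = S at h'
    cases h' with
    | @bump l' R' _ p' _ h' hp' hy' hpy' hmin' =>
      have hS' := fun x => Finset.ext_iff.1 hS x
      simp only [Finset.mem_insert, Finset.mem_erase] at hS'
      obtain rfl : p = p' := by grind
      obtain rfl : R = R' := by grind
      rw [ih h']

theorem length_le_of_sublist (h : RowInsertion l R rec) {p : α} {s : List α}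
    (hs : (p :: s).Sublist l) (hd : (p :: s).Pairwise (· > ·)) :
    s.length + 1 ≤ (R.filter (· ≤ p)).card := by
  have key : ∀ {l : List α} {R R' : Finset α} {q : α},
      (∀ x ∈ R, x < q → x ∈ R') → q ∈ R' →
      (∀ {p : α} {s : List α}, (p :: s).Sublist l → (p :: s).Pairwise (· > ·) →
        s.length + 1 ≤ (R.filter (· ≤ p)).card) →
      ∀ {s : List α}, s.Sublist l → (q :: s).Pairwise (· > ·) →
      s.length + 1 ≤ (R'.filter (· ≤ q)).card := by
    intro l R R' q hR hq ih s hs hd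
    cases s with
    | nil => exact Finset.card_pos.2 ⟨q, by simp [hq]⟩
    | cons p s =>
      have hpq : p < q := by simpa using (List.pairwise_cons.1 hd).1 p (by simp)
      have h1 := ih hs (List.pairwise_cons.1 hd).2
      have h2 : insert q (R.filter (· ≤ p)) ⊆ R'.filter (· ≤ q) := by
        intro x hx
        grind
      have h3 := Finset.card_le_card h2
      rw [Finset.card_insert_of_notMem (by simp [hpq])] at h3
      simp only [List.length_cons]
      omega
  induction h generalizing p s with
  | nil => simp at hs
  | @append l R rec q h hq ih =>
    rcases List.sublist_cons_iff.1 hs with hs | ⟨r, hr, hs⟩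
    · exact (ih hs hd).trans (Finset.card_le_card (by grind))
    · obtain ⟨rfl, rfl⟩ := List.cons.inj hr
      exact key (by grind) (by simp) ih hs hd
  | @bump l R rec q y h hq hy hqy hmin ih =>
    rcases List.sublist_cons_iff.1 hs with hs | ⟨r, hr, hs⟩
    · refine (ih hs hd).trans ?_
      refine Finset.card_le_card_of_injOn (fun x => if x = y then q else x) ?_ ?_
      · intro x hx
        simp only [Finset.coe_filter, Set.mem_ofPred_eq] at hx ⊢
        grind
      · intro x hx z hz hxz
        simp only [Finset.coe_filter, Set.mem_ofPred_eq] at hx hz hxz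
        grind
    · obtain ⟨rfl, rfl⟩ := List.cons.inj hr
      exact key (by grind) (by simp) ih hs hd

theorem exists_sublist_length (h : RowInsertion l R rec) {p : α} (hp : p ∈ R) :
    ∃ s, (p :: s).Sublist l ∧ (p :: s).Pairwise (· > ·) ∧
      s.length + 1 = (R.filter (· ≤ p)).card := by
  have key : ∀ {l : List α} {R R' : Finset α} {q : α},
      (∀ x, x < q → (x ∈ R ↔ x ∈ R')) → q ∈ R' →
      (∀ {p : α}, p ∈ R → ∃ s, (p :: s).Sublist l ∧ (p :: s).Pairwise (· > ·) ∧
        s.length + 1 = (R.filter (· ≤ p)).card) →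
      ∃ s, (q :: s).Sublist (q :: l) ∧ (q :: s).Pairwise (· > ·) ∧
        s.length + 1 = (R'.filter (· ≤ q)).card := by
    intro l R R' q hR hq ih
    rcases (R.filter (· < q)).eq_empty_or_nonempty with h0 | h0
    · refine ⟨[], by simp, by simp, ?_⟩
      have : R'.filter (· ≤ q) = {q} := by
        ext x
        have : x ∉ R.filter (· < q) := by simp [h0]
        grind
      simp [this]
    · obtain ⟨p, hp⟩ : ∃ p, p = (R.filter (· < q)).max' h0 := ⟨_, rfl⟩
      have hpm : p ∈ R.filter (· < q) := hp ▸ Finset.max'_mem _ h0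
      have hpx : ∀ x ∈ R.filter (· < q), x ≤ p := fun x hx => hp ▸ Finset.le_max' _ x hx
      obtain ⟨hpR, hpq⟩ := Finset.mem_filter.1 hpm
      obtain ⟨s, h1, h2, h3⟩ := ih hpR
      refine ⟨p :: s, h1.cons_cons q, ?_, ?_⟩
      · refine List.pairwise_cons.2 ⟨fun x hx => ?_, h2⟩
        rcases List.mem_cons.1 hx with rfl | hx
        · exact hpq
        · exact ((List.pairwise_cons.1 h2).1 x hx).trans hpq
      · have : R'.filter (· ≤ q) = insert q (R.filter (· ≤ p)) := by
          ext x
          grind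
        rw [this, Finset.card_insert_of_notMem (by simp [hpq]), ← h3, List.length_cons]
  induction h generalizing p with
  | nil => simp at hp
  | @append l R rec q h hq ih =>
    rcases Finset.mem_insert.1 hp with rfl | hpR
    · exact key (by grind) (by simp) ih
    · obtain ⟨s, h1, h2, h3⟩ := ih hpR
      refine ⟨s, h1.cons q, h2, h3.trans (congrArg Finset.card ?_)⟩
      grind
  | @bump l R rec q y h hq hy hqy hmin ih =>
    rcases Finset.mem_insert.1 hp with rfl | hpR
    · exact key (by grind) (by simp) ih
    · obtain ⟨hpy, hpR⟩ := Finset.mem_erase.1 hpR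
      obtain ⟨s, h1, h2, h3⟩ := ih hpR
      refine ⟨s, h1.cons q, h2, h3.trans ?_⟩
      rcases lt_or_ge p q with hpq | hpq
      · exact congrArg Finset.card (by grind)
      · have hyp : y ≤ p := hmin p hpR (by grind)
        have : (insert q (R.erase y)).filter (· ≤ p) =
            insert q ((R.filter (· ≤ p)).erase y) := by
          grind
        rw [this, Finset.card_insert_of_notMem (by simp [hq]),
          Finset.card_erase_add_one (by simp [hy, hyp])]

/-- Schensted's theorem for the first row. -/
theorem exists_sublist_iff (h : RowInsertion l R rec) (m : ℕ) :
    (∃ s : List α, s.Sublist l ∧ s.Pairwise (· > ·) ∧ s.length = m) ↔ m ≤ rec.count none := by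
  rw [← h.card_eq]
  constructor
  · rintro ⟨_ | ⟨p, s⟩, hs, hd, rfl⟩
    · simp
    · exact (h.length_le_of_sublist hs hd).trans (Finset.card_filter_le _ _)
  · intro hm
    suffices ∃ s : List α, s.Sublist l ∧ s.Pairwise (· > ·) ∧ s.length = R.card by
      obtain ⟨s, h1, h2, h3⟩ := this
      exact ⟨s.take m, (List.take_sublist m s).trans h1, h2.sublist (List.take_sublist m s),
        by simp [h3, hm]⟩
    rcases R.eq_empty_or_nonempty with rfl | h0
    · exact ⟨[], by simp, by simp, by simp⟩
    · obtain ⟨s, h1, h2, h3⟩ := h.exists_sublist_length (R.max'_mem h0)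
      refine ⟨_, h1, h2, ?_⟩
      rw [List.length_cons, h3, Finset.filter_true_of_mem fun x hx => R.le_max' x hx]

theorem exists_insert {m : ℕ} {ys : List α}
    (h : RowInsertion l R (ys.map some ++ List.replicate m none)) (hl : l.Nodup) {e : α}
    (he : e ∉ l) :
    ∃ l', RowInsertion l' (insert e R) (ys.map some ++ List.replicate (m + 1) none) := by
  induction ys generalizing l R e with
  | nil =>
    obtain ⟨l', h'⟩ := exists_replicate (insert e R)
    rw [Finset.card_insert_of_notMem fun hR => he (h.subset hR), h.card_eq] at h'
    exact ⟨l', by simpa using h'⟩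
  | cons y ys ih =>
    rw [List.map_cons, List.cons_append] at h ⊢
    cases h with
    | @bump l S _ p _ h hp hy hpy hmin =>
      obtain ⟨hpl, hl⟩ := List.nodup_cons.1 hl
      have hyl := h.subset hy
      have heS : e ∉ S := fun hS => he (by simp [h.subset hS])
      have hep : e ≠ p := by rintro rfl; simp at he
      have hey : e ≠ y := by rintro rfl; simp [hyl] at he
      by_cases hb : p < e ∧ e < y
      · obtain ⟨l', h'⟩ := ih h hl hpl
        refine ⟨e :: l', ?_⟩
        have := h'.bump (p := e) (y := y) (by grind) (by grind) hb.2 (by grind)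
        convert this using 1
        grind
      · obtain ⟨l', h'⟩ := ih h hl (e := e) (by grind)
        refine ⟨p :: l', ?_⟩
        have := h'.bump (p := p) (y := y) (by grind) (by grind) hpy (by grind)
        convert this using 1
        grind

theorem exists_erase {m : ℕ} {ys : List α}
    (h : RowInsertion l R (ys.map some ++ List.replicate (m + 1) none)) {e : α} (he : e ∈ R)
    (hcard : ys.length ≤ (R.filter (· < e)).card) :
    ∃ l', RowInsertion l' (R.erase e) (ys.map some ++ List.replicate m none) := by
  induction ys generalizing l R e with
  | nil =>
    obtain ⟨l', h'⟩ := exists_replicate (R.erase e)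
    rw [Finset.card_erase_of_mem he, h.card_eq] at h'
    exact ⟨l', by simpa using h'⟩
  | cons y ys ih =>
    rw [List.map_cons, List.cons_append] at h ⊢
    rw [List.length_cons] at hcard
    cases h with
    | @bump l S _ p _ h hp hy hpy hmin =>
      by_cases hep : e = p
      · subst hep
        have h0 : ((insert e (S.erase y)).filter (· < e)).Nonempty :=
          Finset.card_pos.1 (by omega)
        obtain ⟨x, hx⟩ : ∃ x, x = Finset.max' _ h0 := ⟨_, rfl⟩
        have hxm : x ∈ (insert e (S.erase y)).filter (· < e) := hx ▸ Finset.max'_mem _ h0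
        have hxmax : ∀ z ∈ (insert e (S.erase y)).filter (· < e), z ≤ x :=
          fun z hz => hx ▸ Finset.le_max' _ z hz
        have hsub : (insert e (S.erase y)).filter (· < e) ⊆ insert x (S.filter (· < x)) := by
          intro z hz
          have := hxmax z hz
          grind
        have hc := (Finset.card_le_card hsub).trans (Finset.card_insert_le _ _)
        have hmax : ∀ z ∈ S, z < e → z ≤ x := fun z hz hze => hxmax z (by grind)
        obtain ⟨l', h'⟩ := ih h (e := x) (by grind) (by omega)
        refine ⟨x :: l', ?_⟩
        have := h'.bump (p := x) (y := y) (by grind) (by grind) (by grind) (by grind)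
        convert this using 1
        grind
      · have hsub : ((insert p (S.erase y)).filter (· < e)).card ≤ (S.filter (· < e)).card := by
          refine Finset.card_le_card_of_injOn (fun x => if x = p then y else x) ?_ ?_
          · intro x hx
            simp only [Finset.coe_filter, Set.mem_ofPred_eq] at hx ⊢
            grind
          · intro x hx z hz hxz
            simp only [Finset.coe_filter, Set.mem_ofPred_eq] at hx hz hxz
            grind
        obtain ⟨l', h'⟩ := ih h (e := e) (by grind) (by omega)
        refine ⟨p :: l', ?_⟩
        have := h'.bump (p := p) (y := y) (by grind) (by grind) hpy (by grind)
        convert this using 1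
        grind

end RowInsertion

end RowInsertion

theorem List.exists_eq_map_some_of_count_none_eq_zero {α : Type*} [DecidableEq α]
    {l : List (Option α)} (h : l.count none = 0) : ∃ ys : List α, l = ys.map some := by
  induction l with
  | nil => exact ⟨[], rfl⟩
  | cons x l ih =>
    cases x with
    | none => simp at h
    | some y =>
      obtain ⟨ys, rfl⟩ := ih (by simpa using h)
      exact ⟨y :: ys, rfl⟩

theorem List.count_map_some_append_replicate {α : Type*} [DecidableEq α] (ys : List α) (m : ℕ) :
    (ys.map some ++ List.replicate m none).count none = m := by
  have : (ys.map some).count none = 0 := List.count_eq_zero.2 (by simp)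
  simp [this]

theorem List.reduceOption_map_some_append_replicate {α : Type*} (ys : List α) (m : ℕ) :
    (ys.map some ++ List.replicate m none).reduceOption = ys := by
  simp [List.reduceOption]

theorem List.le_count_iff_eq_replicate {α : Type*} [BEq α] [LawfulBEq α] {l : List α} {x : α} {m : ℕ}
    (h : l.length = m) : m ≤ l.count x ↔ l = List.replicate m x := by
  subst h
  rw [(List.count_le_length (a := x) (l := l)).ge_iff_eq, List.count_eq_length,
    List.eq_replicate_iff]
  simp [eq_comm]

theorem List.exists_perm_ofFn_eq {n : ℕ} {w : Equiv.Perm (Fin n)} {l : List (Fin n)}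
    (h : l.Perm (List.ofFn w)) : ∃ σ : Equiv.Perm (Fin n), List.ofFn σ = l := by
  have hn : l.length = n := by simpa using h.length_eq
  have hd : l.Nodup := h.nodup_iff.2 (List.nodup_ofFn.2 w.injective)
  have hinj : Function.Injective fun i : Fin n => l.get (i.cast hn.symm) :=
    hd.injective_get.comp (Fin.cast_injective _)
  refine ⟨Equiv.ofBijective _ (Finite.injective_iff_bijective.1 hinj), ?_⟩
  refine List.ext_getElem (by simp [hn]) fun i h1 h2 => by simp

/-- The word `w(1) ⋯ w(t)`, read from right to left. -/
def reversedPrefix {n : ℕ} (w : Equiv.Perm (Fin n)) (t : ℕ) : List (Fin n) :=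
  ((List.ofFn w).take t).reverse

section ReversedPrefix

variable {n : ℕ} (w : Equiv.Perm (Fin n))

theorem nodup_reversedPrefix (t : ℕ) : (reversedPrefix w t).Nodup :=
  List.nodup_reverse.2 ((List.nodup_ofFn.2 w.injective).sublist (List.take_sublist _ _))

theorem length_reversedPrefix {t : ℕ} (ht : t ≤ n) : (reversedPrefix w t).length = t := by
  simp [reversedPrefix, ht]

theorem drop_reversedPrefix {t a : ℕ} (hta : t ≤ a) (ha : a ≤ n) :
    (reversedPrefix w a).drop (a - t) = reversedPrefix w t := by
  rw [reversedPrefix, reversedPrefix, List.drop_reverse, List.take_take]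
  congr 2
  simp
  omega

theorem hasIncSubseqPrefix_iff (t k : ℕ) :
    HasIncSubseqPrefix w t k ↔
      ∃ s : List (Fin n), s.Sublist (reversedPrefix w t) ∧ s.Pairwise (· > ·) ∧ s.length = k := by
  have hmem : ∀ x : Fin n, x ∈ (List.finRange n).take t ↔ (x : ℕ) < t := by
    intro x
    rw [List.mem_take_iff_getElem]
    constructor
    · rintro ⟨i, hi, rfl⟩
      simp at hi ⊢
      omega
    · intro hx
      exact ⟨x, by simp [hx], by simp⟩
  have hlt : ((List.finRange n).take t).Pairwise (· < ·) :=
    (List.pairwise_lt_finRange n).sublist (List.take_sublist _ _)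
  have hpre : reversedPrefix w t = (((List.finRange n).take t).map w).reverse := by
    rw [reversedPrefix, List.ofFn_eq_map, List.map_take]
  rw [hpre]
  constructor
  · rintro ⟨f, hf, hft, hwf⟩
    refine ⟨((List.ofFn f).map w).reverse, ?_, ?_, by simp⟩
    · refine List.reverse_sublist.2 (List.Sublist.map _ ?_)
      have hfs : (List.ofFn f).Pairwise (· < ·) := List.pairwise_ofFn.2 fun i j hij => hf hij
      refine List.sublist_of_subperm_of_pairwise (r := (· < ·)) ?_ hfs hlt
      refine List.subperm_of_subset (List.nodup_ofFn.2 hf.injective) fun x hx => ?_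
      obtain ⟨j, rfl⟩ := (List.mem_ofFn' _ _).1 hx
      exact (hmem _).2 (hft j)
    · rw [List.pairwise_reverse, List.map_ofFn, List.pairwise_ofFn]
      exact fun i j hij => hwf hij
  · rintro ⟨s, hs, hd, rfl⟩
    have hs' := List.reverse_sublist.2 hs
    rw [List.reverse_reverse, List.sublist_map_iff] at hs'
    obtain ⟨r, hr, hsr⟩ := hs'
    have hwd : (r.map w).Pairwise (· < ·) := hsr ▸ List.pairwise_reverse.2 hd
    have hlen : s.length = r.length := by simpa using congrArg List.length hsr
    rw [hlen]
    refine ⟨r.get, fun i j hij => List.pairwise_iff_get.1 (hlt.sublist hr) i j hij,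
      fun j => (hmem _).1 (hr.subset (r.get_mem j)), fun i j hij => ?_⟩
    exact List.pairwise_iff_get.1 (List.pairwise_map.1 hwd) i j hij

theorem prefixInc_iff (s : ℕ) : PrefixInc n s w ↔ HasIncSubseqPrefix w (n - s) (n - s) := by
  have hlen := length_reversedPrefix w (Nat.sub_le n s)
  have h1 : PrefixInc n s w ↔ (reversedPrefix w (n - s)).Pairwise (· > ·) := by
    rw [reversedPrefix, List.pairwise_reverse, List.pairwise_iff_getElem]
    constructor
    · intro h i j hi hj hij
      simp only [List.length_take, List.length_ofFn] at hi hj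
      simpa using h ⟨i, by omega⟩ ⟨j, by omega⟩ hij (by simp; omega)
    · intro h i j hij hj
      have hw := h i j (by simp; omega) (by simp; omega) hij
      rwa [List.getElem_take, List.getElem_take, List.getElem_ofFn, List.getElem_ofFn] at hw
  rw [h1, hasIncSubseqPrefix_iff]
  constructor
  · exact fun h => ⟨_, List.Sublist.refl _, h, hlen⟩
  · rintro ⟨s, hs, hd, hk⟩
    rwa [← hs.eq_of_length (hk.trans hlen.symm)]

variable {w} {R : Finset (Fin n)} {rec : List (Option (Fin n))}

theorem RowInsertion.hasIncSubseqPrefix_iff {a t k : ℕ}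
    (h : RowInsertion (reversedPrefix w a) R rec) (hta : t ≤ a) (ha : a ≤ n) :
    HasIncSubseqPrefix w t k ↔ k ≤ (rec.drop (a - t)).count none := by
  obtain ⟨R', h'⟩ := h.drop (a - t)
  rw [drop_reversedPrefix w hta ha] at h'
  rw [_root_.hasIncSubseqPrefix_iff, h'.exists_sublist_iff]

theorem RowInsertion.hasIncSubseqPrefix_self_iff {a t : ℕ}
    (h : RowInsertion (reversedPrefix w a) R rec) (hta : t ≤ a) (ha : a ≤ n) :
    HasIncSubseqPrefix w t t ↔ rec.drop (a - t) = List.replicate t none := by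
  rw [h.hasIncSubseqPrefix_iff hta ha, List.le_count_iff_eq_replicate]
  rw [List.length_drop, h.length_eq, length_reversedPrefix w ha]
  omega

theorem hasIncSubseqPrefix_record_iff {a m : ℕ} (hma : m ≤ a) (ha : a ≤ n) :
    (HasIncSubseqPrefix w m m ∧ ¬ HasIncSubseqPrefix w a (m + 1)) ↔
      ∃ (R : Finset (Fin n)) (ys : List (Fin n)),
        RowInsertion (reversedPrefix w a) R (ys.map some ++ List.replicate m none) := by
  constructor
  · rintro ⟨h1, h2⟩
    obtain ⟨R, rec, h⟩ := RowInsertion.exists_of_nodup (nodup_reversedPrefix w a)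
    rw [h.hasIncSubseqPrefix_self_iff hma ha] at h1
    rw [h.hasIncSubseqPrefix_iff le_rfl ha, Nat.sub_self, List.drop_zero] at h2
    rw [← List.take_append_drop (a - m) rec, h1] at h h2
    rw [List.count_append, List.count_replicate_self] at h2
    obtain ⟨ys, hys⟩ := List.exists_eq_map_some_of_count_none_eq_zero
      (l := rec.take (a - m)) (by omega)
    exact ⟨R, ys, hys ▸ h⟩
  · rintro ⟨R, ys, h⟩
    rw [h.hasIncSubseqPrefix_self_iff hma ha, h.hasIncSubseqPrefix_iff le_rfl ha, Nat.sub_self,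
      List.drop_zero, List.count_map_some_append_replicate]
    refine ⟨?_, by omega⟩
    have hlen := h.length_eq
    rw [length_reversedPrefix w ha] at hlen
    simp only [List.length_append, List.length_map, List.length_replicate] at hlen
    exact List.drop_left' (by simp; omega)

theorem memCa_iff {s t : ℕ} (hst : n - s ≤ t) (ht : t + 1 ≤ n) :
    MemCa n s (t + 1) w ↔ ∃ (R : Finset (Fin n)) (ys : List (Fin n)),
      RowInsertion (reversedPrefix w (t + 1)) R
        (none :: (ys.map some ++ List.replicate (n - s) none)) := by
  have hcons : ∃ p, reversedPrefix w (t + 1) = p :: reversedPrefix w t := by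
    have h1 := drop_reversedPrefix w (Nat.le_succ t) ht
    have h2 := length_reversedPrefix w ht
    cases hl : reversedPrefix w (t + 1) with
    | nil => simp [hl] at h2
    | cons p l => exact ⟨p, by simpa [hl] using h1⟩
  obtain ⟨p, hp⟩ := hcons
  have hrec := hasIncSubseqPrefix_record_iff (w := w) hst (by omega : t ≤ n)
  rw [MemCa, prefixInc_iff, Nat.add_sub_cancel]
  constructor
  · rintro ⟨h1, h2, h3⟩
    obtain ⟨R, ys, h⟩ := hrec.1 ⟨h1, h3⟩
    obtain ⟨S, rec, h'⟩ := RowInsertion.exists_of_nodup (nodup_reversedPrefix w (t + 1))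
    rw [h'.hasIncSubseqPrefix_iff le_rfl ht, Nat.sub_self, List.drop_zero] at h2
    rw [hp] at h' ⊢
    cases h' with
    | append h' hx =>
      obtain ⟨rfl, rfl⟩ := h.unique h'
      exact ⟨_, ys, h.append hx⟩
    | bump h' =>
      obtain ⟨rfl, rfl⟩ := h.unique h'
      rw [List.count_cons_of_ne (by simp), List.count_map_some_append_replicate] at h2
      omega
  · rintro ⟨R, ys, h⟩
    have h2 : HasIncSubseqPrefix w (t + 1) (n - s + 1) := by
      rw [h.hasIncSubseqPrefix_iff le_rfl ht, Nat.sub_self, List.drop_zero, List.count_cons_self,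
        List.count_map_some_append_replicate]
    rw [hp] at h
    cases h with
    | append h hx =>
      obtain ⟨h1, h3⟩ := hrec.2 ⟨_, ys, h⟩
      exact ⟨h1, h2, h3⟩

theorem reversedPrefix_injective {σ : Equiv.Perm (Fin n)} {a : ℕ}
    (h1 : reversedPrefix w a = reversedPrefix σ a)
    (h2 : (List.ofFn w).drop a = (List.ofFn σ).drop a) : w = σ := by
  refine DFunLike.coe_injective (List.ofFn_injective ?_)
  rw [← List.take_append_drop a (List.ofFn w), ← List.take_append_drop a (List.ofFn σ), h2,
    List.reverse_injective h1]

theorem exists_reversedPrefix_eq {l : List (Fin n)} {a : ℕ} (ha : a ≤ n)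
    (h : l.Perm (reversedPrefix w a)) : ∃ σ : Equiv.Perm (Fin n),
      reversedPrefix σ a = l ∧ (List.ofFn w).drop a = (List.ofFn σ).drop a := by
  have hlen := h.length_eq
  rw [length_reversedPrefix w ha] at hlen
  have hperm : (l.reverse ++ (List.ofFn w).drop a).Perm (List.ofFn w) := by
    conv_rhs => rw [← List.take_append_drop a (List.ofFn w)]
    exact ((List.reverse_perm l).trans (h.trans (List.reverse_perm _))).append_right _
  obtain ⟨σ, hσ⟩ := List.exists_perm_ofFn_eq hperm
  refine ⟨σ, ?_, ?_⟩
  · rw [reversedPrefix, hσ, List.take_left' (by simpa using hlen), List.reverse_reverse]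
  · rw [hσ, List.drop_left' (by simpa using hlen)]

end ReversedPrefix

theorem mem_CFinset {n s : ℕ} {w : Equiv.Perm (Fin n)} : w ∈ CFinset n s ↔ PrefixInc n s w := by
  simp [CFinset]

theorem mem_CaFinset {n s a : ℕ} {w : Equiv.Perm (Fin n)} :
    w ∈ CaFinset n s a ↔ MemCa n s a w := by
  simp [CaFinset]

open Classical in
theorem card_CaFinset_eq_card_filter {n s a : ℕ} (hs : 1 ≤ s) (h : 2 * s ≤ n)
    (ha1 : n - s + 1 ≤ a) (ha2 : a ≤ n) :
    (CaFinset n s a).card =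
      ((CFinset n (s - 1)).filter fun w => ¬ HasIncSubseqPrefix w a (n - s + 2)).card := by
  have hm : n - (s - 1) = n - s + 1 := by omega
  have hmemR : ∀ w : Equiv.Perm (Fin n),
      w ∈ (CFinset n (s - 1)).filter (fun w => ¬ HasIncSubseqPrefix w a (n - s + 2)) ↔
      ∃ (R : Finset (Fin n)) (ys : List (Fin n)),
        RowInsertion (reversedPrefix w a) R (ys.map some ++ List.replicate (n - s + 1) none) := by
    intro w
    rw [← hasIncSubseqPrefix_record_iff ha1 ha2, Finset.mem_filter, mem_CFinset, prefixInc_iff, hm]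
  obtain ⟨t, rfl⟩ : ∃ t, a = t + 1 := ⟨a - 1, by omega⟩
  have hmemL : ∀ w : Equiv.Perm (Fin n), w ∈ CaFinset n s (t + 1) ↔ _ := fun w =>
    mem_CaFinset.trans (memCa_iff (by omega) ha2)
  let r : Equiv.Perm (Fin n) → Equiv.Perm (Fin n) → Prop := fun w σ =>
    (List.ofFn w).drop (t + 1) = (List.ofFn σ).drop (t + 1) ∧
    ∃ (R : Finset (Fin n)) (ys : List (Fin n)),
      RowInsertion (reversedPrefix w (t + 1)) R
        (none :: (ys.map some ++ List.replicate (n - s) none)) ∧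
      RowInsertion (reversedPrefix σ (t + 1)) R
        (ys.map some ++ List.replicate (n - s + 1) none)
  have hcancel : ∀ {ys zs : List (Fin n)} {m : ℕ},
      ys.map some ++ List.replicate m none = zs.map some ++ List.replicate m none → ys = zs :=
    fun h => List.map_injective_iff.2 (Option.some_injective _) (List.append_cancel_right h)
  refine le_antisymm (Finset.card_le_card_of_forall_subsingleton r ?_ ?_)
    (Finset.card_le_card_of_forall_subsingleton' r ?_ ?_)
  · intro w hw
    obtain ⟨R, ys, hR⟩ := (hmemL w).1 hw
    have hnd := nodup_reversedPrefix w (t + 1)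
    generalize hl : reversedPrefix w (t + 1) = l at hR hnd
    cases hR with
    | @append l S _ q h' hq =>
      obtain ⟨hql, hnd⟩ := List.nodup_cons.1 hnd
      obtain ⟨l', h''⟩ := h'.exists_insert hnd hql
      have hperm : l'.Perm (reversedPrefix w (t + 1)) := by
        rw [hl]
        refine h''.perm.trans (List.Perm.trans ?_ (h'.append hq).perm.symm)
        rw [List.reduceOption_cons_of_none, List.reduceOption_map_some_append_replicate,
          List.reduceOption_map_some_append_replicate]
      obtain ⟨σ, hσ, hd⟩ := exists_reversedPrefix_eq ha2 hperm
      rw [← hσ] at h''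
      exact ⟨σ, (hmemR σ).2 ⟨_, ys, h''⟩, hd, _, ys, hl ▸ h'.append hq, h''⟩
  · rintro σ - w ⟨-, hd, R, ys, h1, h2⟩ w' ⟨-, hd', R', ys', h1', h2'⟩
    obtain ⟨rfl, hys⟩ := h2.unique h2'
    obtain rfl := hcancel hys
    exact reversedPrefix_injective (h1.injective h1') (hd.trans hd'.symm)
  · intro σ hσ
    obtain ⟨R, ys, hR⟩ := (hmemR σ).1 hσ
    have hcard := hR.card_eq
    rw [List.count_map_some_append_replicate] at hcard
    have hne : R.Nonempty := Finset.card_pos.1 (by omega)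
    have hmem := R.max'_mem hne
    have hlt : R.filter (· < R.max' hne) = R.erase (R.max' hne) := by
      ext x
      have := R.le_max' x
      grind
    have hlen := hR.length_eq
    rw [length_reversedPrefix σ ha2] at hlen
    simp only [List.length_append, List.length_map, List.length_replicate] at hlen
    obtain ⟨l, h'⟩ := hR.exists_erase hmem (by
      rw [hlt, Finset.card_erase_of_mem hmem]
      omega)
    have h'' := h'.append (p := R.max' hne) fun x hx => by
      rw [← hlt] at hx
      exact (Finset.mem_filter.1 hx).2
    rw [Finset.insert_erase hmem] at h''
    have hperm : (R.max' hne :: l).Perm (reversedPrefix σ (t + 1)) := by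
      refine h''.perm.trans (List.Perm.trans ?_ hR.perm.symm)
      rw [List.reduceOption_cons_of_none, List.reduceOption_map_some_append_replicate,
        List.reduceOption_map_some_append_replicate]
    obtain ⟨w, hw, hd⟩ := exists_reversedPrefix_eq ha2 hperm
    rw [← hw] at h''
    exact ⟨w, (hmemL w).2 ⟨_, ys, h''⟩, hd.symm, _, ys, h'', hR⟩
  · rintro w - σ ⟨-, hd, R, ys, h1, h2⟩ σ' ⟨-, hd', R', ys', h1', h2'⟩
    obtain ⟨rfl, hys⟩ := h1.unique h1'
    obtain rfl := hcancel (List.cons.inj hys).2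
    exact reversedPrefix_injective (h2.injective h2') (hd.symm.trans hd')

theorem HasIncSubseqPrefix.mono {n a b m : ℕ} {w : Equiv.Perm (Fin n)}
    (h : HasIncSubseqPrefix w a m) (hab : a ≤ b) : HasIncSubseqPrefix w b m :=
  let ⟨f, h1, h2, h3⟩ := h
  ⟨f, h1, fun j => (h2 j).trans_le hab, h3⟩

theorem HasIncSubseqPrefix.le {n a m : ℕ} {w : Equiv.Perm (Fin n)}
    (h : HasIncSubseqPrefix w a m) : m ≤ a := by
  obtain ⟨f, h1, h2, -⟩ := h
  simpa using Fintype.card_le_of_injective (fun j : Fin m => (⟨f j, h2 j⟩ : Fin a))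
    fun i j hij => h1.injective (Fin.ext (by simpa using hij))

open Classical in
theorem card_filter_add_sum_card_CaFinset {n s a : ℕ} (ha : n - s ≤ a) :
    ((CFinset n s).filter fun w => ¬ HasIncSubseqPrefix w a (n - s + 1)).card +
      ∑ b ∈ Finset.Icc (n - s + 1) a, (CaFinset n s b).card = (CFinset n s).card := by
  induction a, ha using Nat.le_induction with
  | base =>
    rw [Finset.Icc_eq_empty (by omega), Finset.sum_empty, add_zero,
      Finset.filter_true_of_mem fun w _ hw => by have := hw.le; omega]
  | succ a ha ih =>
    rw [Finset.sum_Icc_succ_top (by omega), ← ih, add_comm (∑ _ ∈ _, _), ← add_assoc,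
      ← Finset.card_union_of_disjoint]
    · congr 2
      ext w
      simp only [Finset.mem_union, Finset.mem_filter, mem_CFinset, mem_CaFinset, MemCa,
        Nat.add_sub_cancel]
      have : HasIncSubseqPrefix w a (n - s + 1) → HasIncSubseqPrefix w (a + 1) (n - s + 1) :=
        fun h => h.mono (Nat.le_succ a)
      tauto
    · rw [Finset.disjoint_left]
      intro w h1 h2
      exact (Finset.mem_filter.1 h1).2 (mem_CaFinset.1 h2).2.1

/-- For `n >= 2s`, `s >= 1` and `n-s+1 ≤ a ≤ n`,
`#C_{n,s,a} = #C_{n,s-1} - sum_{b=n-s+2}^{a} #C_{n,s-1,b}`. -/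
theorem ca_card (n s a : ℕ) (hs : 1 ≤ s) (h : 2 * s ≤ n)
    (ha1 : n - s + 1 ≤ a) (ha2 : a ≤ n) :
    ((CaFinset n s a).card : ℤ) =
      ((CFinset n (s - 1)).card : ℤ) -
        ∑ b ∈ Finset.Icc (n - s + 2) a, ((CaFinset n (s - 1) b).card : ℤ) := by
  have hm : n - (s - 1) = n - s + 1 := by omega
  have hsum := card_filter_add_sum_card_CaFinset (n := n) (s := s - 1) (a := a) (by omega)
  rw [hm, ← card_CaFinset_eq_card_filter hs h ha1 ha2] at hsum
  rw [← hsum]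
  push_cast
  ring
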